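/- arXiv:2111.04002 — 2 statements merged into one kernel-verified Lean document; each statement's English description precedes it below -/
import Mathlib

section
/- Let W_p = p·Γ[|φ⁺⟩⟨φ⁺|] + (1−p)·I/4 on ℂ²⊗ℂ² with 0 ≤ p ≤ 1/2. Then the correlations of W_p for local projective measurements admit a local hidden variable model: there exist a measurable space Λ, a probability measure ω on Λ, and response functions f, g : {rank-one projections on ℂ²} × Λ → [0,1] satisfying f(P,λ) + f(I−P,λ) = 1 and g(Q,λ) + g(I−Q,λ) = 1 for all rank-one projections P, Q and all λ, such that for all rank-one projections P, Q on ℂ²: Tr[W_p (P ⊗ Q)] = ∫_Λ f(P,λ) · g(Q,λ) dω(λ). -/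
open Matrix Kronecker ComplexOrder

/-- The maximally entangled vector |φ⁺⟩ = (|00⟩+|11⟩)/√2 on ℂ²⊗ℂ². -/
noncomputable def phiPlus : Fin 2 × Fin 2 → ℂ :=
  fun x => if x.1 = x.2 then (((Real.sqrt 2)⁻¹ : ℝ) : ℂ) else 0

/-- The projector |φ⁺⟩⟨φ⁺|. -/
noncomputable def phiPlusProj : Matrix (Fin 2 × Fin 2) (Fin 2 × Fin 2) ℂ :=
  Matrix.of fun x y => phiPlus x * (starRingEnd ℂ) (phiPlus y)

/-- The partial transpose (on the second factor) of |φ⁺⟩⟨φ⁺|. -/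
noncomputable def phiPlusPT : Matrix (Fin 2 × Fin 2) (Fin 2 × Fin 2) ℂ :=
  Matrix.of fun x y => phiPlusProj (x.1, y.2) (y.1, x.2)

/-- The family W_p = p·Γ[|φ⁺⟩⟨φ⁺|] + (1−p)·I/4. -/
noncomputable def Wp (p : ℝ) : Matrix (Fin 2 × Fin 2) (Fin 2 × Fin 2) ℂ :=
  (p : ℂ) • phiPlusPT + (((1 - p : ℝ) : ℂ) / 4) • (1 : Matrix (Fin 2 × Fin 2) (Fin 2 × Fin 2) ℂ)

/-- A rank-one projection on ℂ^d: Hermitian, idempotent, trace 1. -/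
def RankOneProj {d : ℕ} (P : Matrix (Fin d) (Fin d) ℂ) : Prop :=
  P.IsHermitian ∧ P * P = P ∧ P.trace = 1

/-- A local hidden variable model, for projective measurements, of a bipartite qubit
operator σ: a probability space (Hidden, ω) and response functions f, g on rank-one
projections, valued in [0,1] with f(P,λ) + f(I−P,λ) = 1 and g(Q,λ) + g(I−Q,λ) = 1,
reproducing all joint Born probabilities Tr[σ(P ⊗ Q)]. -/
structure LHVModelProj (σ : Matrix (Fin 2 × Fin 2) (Fin 2 × Fin 2) ℂ) where
  Hidden : Type
  [mHidden : MeasurableSpace Hidden]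
  ω : MeasureTheory.Measure Hidden
  prob : MeasureTheory.IsProbabilityMeasure ω
  f : Matrix (Fin 2) (Fin 2) ℂ → Hidden → ℝ
  g : Matrix (Fin 2) (Fin 2) ℂ → Hidden → ℝ
  f_mem : ∀ P, RankOneProj P → ∀ lam, 0 ≤ f P lam ∧ f P lam ≤ 1
  g_mem : ∀ Q, RankOneProj Q → ∀ lam, 0 ≤ g Q lam ∧ g Q lam ≤ 1
  f_sum : ∀ P, RankOneProj P → ∀ lam, f P lam + f (1 - P) lam = 1
  g_sum : ∀ Q, RankOneProj Q → ∀ lam, g Q lam + g (1 - Q) lam = 1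
  born : ∀ P Q, RankOneProj P → RankOneProj Q →
    (σ * (P ⊗ₖ Q)).trace = ((∫ lam, f P lam * g Q lam ∂ω : ℝ) : ℂ)

section Helpers
open MeasureTheory

noncomputable abbrev E3 := EuclideanSpace ℝ (Fin 3)
lemma gauss3 : ∫ r in Set.Ioi (0:ℝ), r ^ (3:ℝ) * Real.exp (-r ^ (2:ℝ)) = 1/2 := by
  rw [integral_rpow_mul_exp_neg_rpow (by norm_num) (by norm_num)]
  norm_num
lemma gauss1 : ∫ r in Set.Ioi (0:ℝ), r ^ (1:ℝ) * Real.exp (-r ^ (2:ℝ)) = 1/2 := by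
  rw [integral_rpow_mul_exp_neg_rpow (by norm_num) (by norm_num)]
  norm_num
lemma gaussAbs : ∫ r : ℝ, |r| * Real.exp (-r ^ 2) = 1 := by
  have := integral_comp_abs (f := fun r : ℝ => r * Real.exp (-r ^ 2))
  simp only [sq_abs] at this
  rw [this]
  have h := gauss1
  norm_num at h
  rw [h]; norm_num
lemma Zint : ∫ x : E3, ‖x‖ * Real.exp (-‖x‖ ^ 2) = 2 * Real.pi := by
  have := integral_fun_norm_addHaar (volume : Measure E3) (fun r => r * Real.exp (-r ^ 2))
  rw [this]
  have h : ∫ r in Set.Ioi (0:ℝ), r ^ 2 * (r * Real.exp (-r ^ 2)) = 1/2 := by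
    rw [← gauss3]
    congr 1
    ext r
    norm_num
    ring
  have hv : (volume : Measure E3).real (Metric.ball 0 1) = 4/3 * Real.pi := by
    rw [Measure.real, EuclideanSpace.volume_ball_fin_three]
    rw [ENNReal.toReal_mul, ENNReal.toReal_ofReal (by positivity)]
    simp
    ring
  simp [h, hv]
  ring
lemma Nint : ∫ x : E3, |x 2| * Real.exp (-‖x‖ ^ 2) = Real.pi := by
  have h := (EuclideanSpace.volume_preserving_symm_measurableEquiv_toLp (Fin 3)).symm.integral_comp' (fun x : E3 => |x 2| * Real.exp (-‖x‖ ^ 2))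
  rw [← h]
  have h2 := integral_fintype_prod_eq_prod (𝕜 := ℝ) (ι := Fin 3) (fun i r => (if i = 2 then |r| else 1) * Real.exp (-r^2)) (μ := fun _ => (volume : Measure ℝ))
  simp only [Fin.prod_univ_three] at h2
  have hg := integral_gaussian 1
  simp at hg
  simp [gaussAbs, hg] at h2
  rw [Real.mul_self_sqrt Real.pi_pos.le] at h2
  rw [← h2, ← volume_pi]
  congr 1
  ext x
  simp [EuclideanSpace.norm_sq_eq, Fin.sum_univ_three]
  simp only [Real.exp_add]
  ring


lemma isoInt (R : E3 ≃ₗᵢ[ℝ] E3) (F : E3 → ℝ) : ∫ x, F (R x) = ∫ x, F x :=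
  (R.measurePreserving).integral_comp' (f := R.toHomeomorph.toMeasurableEquiv) F

lemma Nint' (a : E3) (ha : ‖a‖ = 1) : ∫ x : E3, |inner ℝ a x| * Real.exp (-‖x‖ ^ 2) = Real.pi := by
  rw [← Nint]
  set w : E3 := EuclideanSpace.single 2 1
  have h := Submodule.reflection_sub (v := a) (w := w) (by simp [w, ha])
  rw [← isoInt (Submodule.reflection (Submodule.span ℝ {a - w})ᗮ)]
  set R := Submodule.reflection (Submodule.span ℝ {a - w})ᗮ
  have h3 : R w = a := by rw [← h]; simp [R]
  congr 1
  ext x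
  rw [R.norm_map]
  nth_rewrite 1 [← h3]
  rw [R.inner_map_map]
  simp [w, EuclideanSpace.inner_single_left]

lemma measSign : Measurable Real.sign := by
  unfold Real.sign
  exact Measurable.ite measurableSet_Iio measurable_const (Measurable.ite measurableSet_Ioi measurable_const measurable_const)

lemma sign_abs_le (r : ℝ) : |Real.sign r| ≤ 1 := by
  rcases Real.sign_apply_eq r with h | h | h <;> simp [h]

lemma Iint (a b : E3) : Integrable (fun x : E3 => Real.sign (inner ℝ a x) * inner ℝ b x * Real.exp (-‖x‖ ^ 2)) := by
  have h0 : Integrable (fun x : E3 => ‖x‖ * Real.exp (-‖x‖ ^ 2)) :=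
    Integrable.of_integral_ne_zero (by rw [Zint]; positivity)
  refine (h0.const_mul ‖b‖).mono' ?_ ?_
  · have := measSign
    apply Measurable.aestronglyMeasurable
    fun_prop
  · refine Filter.Eventually.of_forall fun x => ?_
    rw [norm_mul, norm_mul, Real.norm_eq_abs, Real.norm_eq_abs, Real.norm_eq_abs, abs_of_pos (Real.exp_pos _), ← mul_assoc]
    have := sign_abs_le (inner ℝ a x)
    have h2 := abs_real_inner_le_norm b x
    refine mul_le_mul_of_nonneg_right ?_ (Real.exp_pos _).le
    nlinarith [abs_nonneg (inner ℝ b x)]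

lemma sign_mul_self' (r : ℝ) : Real.sign r * r = |r| := by
  rcases lt_trichotomy r 0 with h | h | h
  · simp [Real.sign_of_neg h, abs_of_neg h]
  · simp [h]
  · simp [Real.sign_of_pos h, abs_of_pos h]

lemma Mint (a b : E3) (ha : ‖a‖ = 1) :
    ∫ x : E3, Real.sign (inner ℝ a x) * inner ℝ b x * Real.exp (-‖x‖ ^ 2) = Real.pi * inner ℝ a b := by
  set R := Submodule.reflection (Submodule.span ℝ {a})
  have hR : ∀ v, R v = (2 * inner ℝ a v) • a - v := by
    intro v
    have := Submodule.reflection_singleton_apply (𝕜 := ℝ) a v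
    simp only [R, this, ha]
    simp [mul_smul, two_smul]
  have hRa : R a = a := by
    rw [hR, real_inner_self_eq_norm_sq, ha]; module
  have h1 := isoInt R (fun x : E3 => Real.sign (inner ℝ a x) * inner ℝ b x * Real.exp (-‖x‖ ^ 2))
  have key : ∀ x, Real.sign (inner ℝ a (R x)) * inner ℝ b (R x) * Real.exp (-‖R x‖ ^ 2)
      = 2 * inner ℝ a b * (|inner ℝ a x| * Real.exp (-‖x‖ ^ 2)) - Real.sign (inner ℝ a x) * inner ℝ b x * Real.exp (-‖x‖ ^ 2) := by
    intro x
    rw [R.norm_map, ← sign_mul_self', hR, inner_sub_right, inner_sub_right, inner_smul_right, inner_smul_right,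
      real_inner_self_eq_norm_sq, ha, real_inner_comm a b]
    ring_nf
  simp only [key] at h1
  have hi : Integrable (fun x : E3 => |inner ℝ a x| * Real.exp (-‖x‖ ^ 2)) := by
    simpa [sign_mul_self'] using Iint a a
  rw [integral_sub (hi.const_mul _) (Iint a b), integral_const_mul, Nint' a ha] at h1
  linarith

noncomputable def rhoW (x : E3) : ℝ := (2 * Real.pi)⁻¹ * (‖x‖ * Real.exp (-‖x‖ ^ 2))

lemma rhoW_nonneg (x : E3) : 0 ≤ rhoW x := by unfold rhoW; positivity

lemma rhoW_meas : Measurable rhoW := by unfold rhoW; fun_prop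

lemma rhoW_int : ∫ x, rhoW x = 1 := by
  unfold rhoW
  rw [integral_const_mul, Zint]
  exact inv_mul_cancel₀ (by positivity)

noncomputable def muW : Measure E3 := volume.withDensity (fun x => ENNReal.ofReal (rhoW x))

lemma muW_prob : IsProbabilityMeasure muW := by
  constructor
  rw [muW, withDensity_apply _ MeasurableSet.univ, Measure.restrict_univ,
    ← ofReal_integral_eq_lintegral_ofReal, rhoW_int, ENNReal.ofReal_one]
  · exact Integrable.of_integral_ne_zero (by rw [rhoW_int]; norm_num)
  · exact Filter.Eventually.of_forall rhoW_nonneg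

lemma muW_integral (F : E3 → ℝ) : ∫ x, F x ∂muW = ∫ x, rhoW x * F x := by
  rw [muW, integral_withDensity_eq_integral_toReal_smul rhoW_meas.ennreal_ofReal (by simp)]
  simp [ENNReal.toReal_ofReal (rhoW_nonneg _)]

lemma muW_odd (F : E3 → ℝ) (hF : ∀ x, F (-x) = - F x) : ∫ x, F x ∂muW = 0 := by
  rw [muW_integral]
  have h := integral_neg_eq_self (fun x => rhoW x * F x) (volume : Measure E3)
  have e : ∀ x, rhoW (-x) * F (-x) = -(rhoW x * F x) := by
    intro x; rw [hF, rhoW, rhoW, norm_neg]; ring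
  simp only [e, integral_neg] at h
  linarith

lemma muW_corr (a b : E3) (ha : ‖a‖ = 1) :
    ∫ x, Real.sign (inner ℝ a x) * (inner ℝ b x / ‖x‖) ∂muW = inner ℝ a b / 2 := by
  rw [muW_integral]
  have e : ∀ x : E3, rhoW x * (Real.sign (inner ℝ a x) * (inner ℝ b x / ‖x‖)) =
      (2 * Real.pi)⁻¹ * (Real.sign (inner ℝ a x) * inner ℝ b x * Real.exp (-‖x‖ ^ 2)) := by
    intro x
    by_cases hx : x = 0
    · simp [hx]
    · have : ‖x‖ ≠ 0 := norm_ne_zero_iff.mpr hx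
      unfold rhoW
      field_simp
  simp only [e]
  rw [integral_const_mul, Mint a b ha]
  have := Real.pi_pos
  field_simp

lemma inner_div_le (b x : E3) (hb : ‖b‖ = 1) : |inner ℝ b x / ‖x‖| ≤ 1 := by
  rw [abs_div, abs_norm]
  apply div_le_one_of_le₀ _ (norm_nonneg _)
  simpa [hb] using abs_real_inner_le_norm b x

lemma muW_born (p : ℝ) (a b : E3) (ha : ‖a‖ = 1) (hb : ‖b‖ = 1) :
    ∫ x, ((1 + Real.sign (inner ℝ a x)) / 2) * ((1 + 2 * p * (inner ℝ b x / ‖x‖)) / 2) ∂muW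
      = (1 + p * inner ℝ a b) / 4 := by
  have := muW_prob
  have hs := measSign
  have i1 : Integrable (fun x : E3 => Real.sign (inner ℝ a x)) muW :=
    Integrable.of_bound (C := 1) (by apply Measurable.aestronglyMeasurable; fun_prop)
      (Filter.Eventually.of_forall fun x => sign_abs_le _)
  have i2 : Integrable (fun x : E3 => inner ℝ b x / ‖x‖) muW :=
    Integrable.of_bound (C := 1) (by apply Measurable.aestronglyMeasurable; fun_prop)
      (Filter.Eventually.of_forall fun x => inner_div_le b x hb)
  have i3 : Integrable (fun x : E3 => Real.sign (inner ℝ a x) * (inner ℝ b x / ‖x‖)) muW :=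
    Integrable.of_bound (C := 1) (by apply Measurable.aestronglyMeasurable; fun_prop)
      (Filter.Eventually.of_forall fun x => by
        rw [norm_mul]
        exact mul_le_one₀ (sign_abs_le _) (norm_nonneg _) (inner_div_le b x hb))
  have e : ∀ x : E3, ((1 + Real.sign (inner ℝ a x)) / 2) * ((1 + 2 * p * (inner ℝ b x / ‖x‖)) / 2)
      = 1/4 + (1/4 * Real.sign (inner ℝ a x) + (p/2 * (inner ℝ b x / ‖x‖) +
        p/2 * (Real.sign (inner ℝ a x) * (inner ℝ b x / ‖x‖)))) := by
    intro x; ring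
  simp only [e]
  have j2 : Integrable (fun x : E3 => p/2 * (inner ℝ b x / ‖x‖) +
        p/2 * (Real.sign (inner ℝ a x) * (inner ℝ b x / ‖x‖))) muW :=
    (i2.const_mul _).add (i3.const_mul _)
  have j1 : Integrable (fun x : E3 => 1/4 * Real.sign (inner ℝ a x) + (p/2 * (inner ℝ b x / ‖x‖) +
        p/2 * (Real.sign (inner ℝ a x) * (inner ℝ b x / ‖x‖)))) muW :=
    (i1.const_mul _).add j2
  rw [integral_add (integrable_const _) j1, integral_add (i1.const_mul _) j2,
    integral_add (i2.const_mul _) (i3.const_mul _), integral_const_mul, integral_const_mul,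
    integral_const_mul, muW_corr a b ha,
    muW_odd (fun x => Real.sign (inner ℝ a x)) (by intro x; simp [Real.sign_neg]),
    muW_odd (fun x => inner ℝ b x / ‖x‖) (by intro x; simp [neg_div])]
  simp; ring

noncomputable def bloch (P : Matrix (Fin 2) (Fin 2) ℂ) : E3 :=
  !₂[2 * (P 0 1).re, 2 * (P 0 1).im, (P 0 0).re - (P 1 1).re]

lemma bloch_compl (P : Matrix (Fin 2) (Fin 2) ℂ) : bloch (1 - P) = - bloch P := by
  ext i
  fin_cases i <;> simp [bloch]

lemma proj_form (P : Matrix (Fin 2) (Fin 2) ℂ) (h : RankOneProj P) :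
    (P 1 0).re = (P 0 1).re ∧ (P 1 0).im = - (P 0 1).im ∧ (P 0 0).im = 0 ∧ (P 1 1).im = 0 ∧
    (P 1 1).re = 1 - (P 0 0).re ∧
    (P 0 0).re ^ 2 + (P 0 1).re ^ 2 + (P 0 1).im ^ 2 = (P 0 0).re := by
  obtain ⟨h1, h2, h3⟩ := h
  have a1 := h1.apply 0 1
  have a2 := h1.apply 0 0
  have a3 := h1.apply 1 1
  have b := congrFun (congrFun h2 0) 0
  rw [Matrix.mul_apply, Fin.sum_univ_two] at b
  rw [Matrix.trace_fin_two] at h3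
  simp only [Complex.ext_iff, Complex.add_re, Complex.add_im, Complex.mul_re, Complex.mul_im,
    Complex.star_def, Complex.conj_re, Complex.conj_im, Complex.one_re, Complex.one_im] at a1 a2 a3 b h3
  obtain ⟨a1, a1'⟩ := a1
  obtain ⟨a2, a2'⟩ := a2
  obtain ⟨a3, a3'⟩ := a3
  have c2 : (P 0 0).im = 0 := by linarith
  have c3 : (P 1 0).im = - (P 0 1).im := by linarith
  refine ⟨a1, c3, c2, by linarith, by linarith [h3.1], ?_⟩
  have := b.1
  rw [a1, c3, c2] at this
  linarith

lemma bloch_norm (P : Matrix (Fin 2) (Fin 2) ℂ) (h : RankOneProj P) : ‖bloch P‖ = 1 := by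
  obtain ⟨h1, h2, h3, h4, h5, h6⟩ := proj_form P h
  have : ‖bloch P‖ ^ 2 = 1 := by
    rw [EuclideanSpace.norm_sq_eq, Fin.sum_univ_three]
    simp [bloch, h5, mul_pow]
    nlinarith
  nlinarith [norm_nonneg (bloch P)]

lemma Wp_born (p : ℝ) (P Q : Matrix (Fin 2) (Fin 2) ℂ) (hP : RankOneProj P) (hQ : RankOneProj Q) :
    (Wp p * (P ⊗ₖ Q)).trace = (((1 + p * inner ℝ (bloch P) (bloch Q)) / 4 : ℝ) : ℂ) := by
  obtain ⟨h1, h2, h3, h4, h5, h6⟩ := proj_form P hP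
  obtain ⟨k1, k2, k3, k4, k5, k6⟩ := proj_form Q hQ
  have hs : (((Real.sqrt 2 : ℝ) : ℂ))⁻¹ * (((Real.sqrt 2 : ℝ) : ℂ))⁻¹ = 1/2 := by
    rw [← mul_inv, ← Complex.ofReal_mul, Real.mul_self_sqrt (by norm_num)]; norm_num
  have e : (Wp p * (P ⊗ₖ Q)).trace = p / 2 * (P 0 0 * Q 0 0 + P 0 1 * Q 1 0 + P 1 0 * Q 0 1 + P 1 1 * Q 1 1)
      + (1 - p) / 4 * ((P 0 0 + P 1 1) * (Q 0 0 + Q 1 1)) := by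
    simp [Matrix.trace, Matrix.mul_apply, Fintype.sum_prod_type, Fin.sum_univ_two, Wp, phiPlusPT,
      phiPlusProj, phiPlus, Matrix.one_apply, hs]
    ring
  have i : inner ℝ (bloch P) (bloch Q) = 4 * ((P 0 1).re * (Q 0 1).re) + 4 * ((P 0 1).im * (Q 0 1).im)
      + ((P 0 0).re - (P 1 1).re) * ((Q 0 0).re - (Q 1 1).re) := by
    simp [bloch, PiLp.inner_apply, Fin.sum_univ_three]
    ring
  have q00 : P 0 0 = ((P 0 0).re : ℂ) := by apply Complex.ext <;> simp [h3]
  have q11 : P 1 1 = ((1 - (P 0 0).re : ℝ) : ℂ) := by apply Complex.ext <;> simp [h4, h5]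
  have q01 : P 0 1 = ((P 0 1).re : ℂ) + (P 0 1).im * Complex.I := by simp
  have q10 : P 1 0 = ((P 0 1).re : ℂ) - (P 0 1).im * Complex.I := by apply Complex.ext <;> simp [h1, h2]
  have r00 : Q 0 0 = ((Q 0 0).re : ℂ) := by apply Complex.ext <;> simp [k3]
  have r11 : Q 1 1 = ((1 - (Q 0 0).re : ℝ) : ℂ) := by apply Complex.ext <;> simp [k4, k5]
  have r01 : Q 0 1 = ((Q 0 1).re : ℂ) + (Q 0 1).im * Complex.I := by simp
  have r10 : Q 1 0 = ((Q 0 1).re : ℂ) - (Q 0 1).im * Complex.I := by apply Complex.ext <;> simp [k1, k2]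
  rw [e, i, h5, k5, q10, q11, r10, r11, q00, r00, q01, r01]
  generalize (P 0 0).re = x1
  generalize (Q 0 0).re = y1
  generalize (P 0 1).re = x2
  generalize (Q 0 1).re = y2
  generalize (P 0 1).im = x3
  generalize (Q 0 1).im = y3
  have t1 : ∀ u v : ℝ, ((u : ℂ) + v * Complex.I).re = u := by intro u v; simp
  have t2 : ∀ u v : ℝ, ((u : ℂ) + v * Complex.I).im = v := by intro u v; simp
  simp only [t1, t2]
  push_cast
  linear_combination (-(p:ℂ) * x3 * y3) * Complex.I_sq

end Helpers

/-- for 0 ≤ p ≤ 1/2, the correlations of W_p under local projective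
measurements admit a local hidden variable model. -/
theorem stmt4 (p : ℝ) (hp0 : 0 ≤ p) (hp1 : p ≤ 1 / 2) :
    Nonempty (LHVModelProj (Wp p)) := by
  refine ⟨{
    Hidden := E3
    ω := muW
    prob := muW_prob
    f := fun P x => (1 + Real.sign (inner ℝ (bloch P) x)) / 2
    g := fun Q x => (1 + 2 * p * (inner ℝ (bloch Q) x / ‖x‖)) / 2
    f_mem := ?_
    g_mem := ?_
    f_sum := ?_
    g_sum := ?_
    born := ?_ }⟩
  · intro P _ x
    have := abs_le.mp (sign_abs_le (inner ℝ (bloch P) x))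
    constructor <;> linarith
  · intro Q hQ x
    have := abs_le.mp (inner_div_le (bloch Q) x (bloch_norm Q hQ))
    constructor <;> nlinarith
  · intro P _ x
    simp only [bloch_compl, inner_neg_left, Real.sign_neg]
    ring
  · intro P _ x
    simp only [bloch_compl, inner_neg_left]
    ring
  · intro P Q hP hQ
    rw [Wp_born p P Q hP hQ, muW_born p _ _ (bloch_norm P hP) (bloch_norm Q hQ)]
end

section
/- Every Hermitian matrix χ on ℂ^{d_A}⊗ℂ^{d_B} admits a decomposition χ = Σ_{s,t} β_{s,t} · (ψ_s)ᵀ ⊗ (φ_t)ᵀ where the β_{s,t} are real numbers, the ψ_s are rank-one projections on ℂ^{d_A}, the φ_t are rank-one projections on ℂ^{d_B}, and ᵀ denotes transposition in the computational basis. -/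
open Matrix Kronecker ComplexOrder

theorem aux_vec {d : ℕ} (v : Fin d → ℂ) :
    vecMulVec v (star v) ∈ Submodule.span ℂ {P : Matrix (Fin d) (Fin d) ℂ | RankOneProj P} := by
  by_cases hv : v = 0
  · subst hv
    simp
  have hn : star v ⬝ᵥ v ≠ 0 := by
    simpa using hv
  have hst : star (star v ⬝ᵥ v) = star v ⬝ᵥ v := by
    simp [dotProduct, mul_comm]
  have : vecMulVec v (star v)
      = (star v ⬝ᵥ v) • ((star v ⬝ᵥ v)⁻¹ • vecMulVec v (star v)) := by
    rw [smul_smul, mul_inv_cancel₀ hn, one_smul]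
  rw [this]
  refine Submodule.smul_mem _ _ (Submodule.subset_span ⟨?_, ?_, ?_⟩)
  · unfold Matrix.IsHermitian
    rw [conjTranspose_smul, conjTranspose_vecMulVec, star_star, star_inv₀, hst]
  · rw [smul_mul_smul_comm, vecMulVec_mul_vecMulVec]
    ext i j
    simp [vecMulVec_apply]
    field_simp
  · rw [trace_smul, trace_vecMulVec, dotProduct_comm v, smul_eq_mul, inv_mul_cancel₀ hn]

theorem aux_span {d : ℕ} :
    Submodule.span ℂ {P : Matrix (Fin d) (Fin d) ℂ | RankOneProj P} = ⊤ := by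
  rw [eq_top_iff]
  rintro M -
  have key : ∀ v w : Fin d → ℂ, vecMulVec v (star w) ∈
      Submodule.span ℂ {P : Matrix (Fin d) (Fin d) ℂ | RankOneProj P} := by
    intro v w
    have : vecMulVec v (star w) = (1/4 : ℂ) • (vecMulVec (v + w) (star (v + w))
        - vecMulVec (v - w) (star (v - w))
        + Complex.I • vecMulVec (v + Complex.I • w) (star (v + Complex.I • w))
        - Complex.I • vecMulVec (v - Complex.I • w) (star (v - Complex.I • w))) := by
      ext i j
      simp [vecMulVec_apply]
      ring_nf
      simp only [Complex.I_sq]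
      ring_nf
    rw [this]
    refine Submodule.smul_mem _ _ (Submodule.sub_mem _ (Submodule.add_mem _
      (Submodule.sub_mem _ ?_ ?_) (Submodule.smul_mem _ _ ?_)) (Submodule.smul_mem _ _ ?_)) <;>
    exact aux_vec _
  rw [matrix_eq_sum_single M]
  refine Submodule.sum_mem _ fun i _ => Submodule.sum_mem _ fun j _ => ?_
  have h := Submodule.smul_mem _ (M i j) (key (Pi.single i 1) (Pi.single j 1))
  convert h using 1
  ext a b
  by_cases ha : i = a <;> by_cases hb : j = b <;>
    simp [vecMulVec_apply, Matrix.single_apply, Pi.single_apply, ha, hb, eq_comm (a := a),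
      eq_comm (a := b)]

theorem aux_family (d : ℕ) : ∃ (S : ℕ) (ψ : Fin S → Matrix (Fin d) (Fin d) ℂ),
    (∀ s, RankOneProj (ψ s)) ∧
    ∀ M : Matrix (Fin d) (Fin d) ℂ, ∃ c : Fin S → ℂ, M = ∑ s, c s • (ψ s)ᵀ := by
  have hfg : (Submodule.span ℂ {P : Matrix (Fin d) (Fin d) ℂ | RankOneProj P}).FG :=
    IsNoetherian.noetherian _
  obtain ⟨t, ht, hspan⟩ := Submodule.fg_span_iff_fg_span_finset_subset _ |>.1 hfg
  rw [aux_span] at hspan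
  refine ⟨t.card, fun s => (t.equivFin.symm s : Matrix (Fin d) (Fin d) ℂ),
    fun s => ht (t.equivFin.symm s).2, fun M => ?_⟩
  have hr : Set.range (fun s => (t.equivFin.symm s : Matrix (Fin d) (Fin d) ℂ)) = (t : Set _) := by
    ext x
    constructor
    · rintro ⟨s, rfl⟩
      exact (t.equivFin.symm s).2
    · intro hx
      exact ⟨t.equivFin ⟨x, hx⟩, by simp⟩
  have hM : Mᵀ ∈ Submodule.span ℂ
      (Set.range (fun s => (t.equivFin.symm s : Matrix (Fin d) (Fin d) ℂ))) := by
    rw [hr, ← hspan]; trivial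
  obtain ⟨c, hc⟩ := (Submodule.mem_span_range_iff_exists_fun ℂ).1 hM
  refine ⟨c, ?_⟩
  rw [← transpose_transpose M, ← hc, transpose_sum]
  simp only [transpose_smul]

/-- every Hermitian matrix χ on ℂ^{d_A}⊗ℂ^{d_B} decomposes as
χ = Σ_{s,t} β_{s,t} · (ψ_s)ᵀ ⊗ (φ_t)ᵀ with real β_{s,t} and rank-one projections ψ_s, φ_t,
where ᵀ is transposition in the computational basis. -/
theorem stmt8 {dA dB : ℕ} (χ : Matrix (Fin dA × Fin dB) (Fin dA × Fin dB) ℂ)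
    (hχ : χ.IsHermitian) :
    ∃ (S T : ℕ) (β : Fin S → Fin T → ℝ)
      (ψ : Fin S → Matrix (Fin dA) (Fin dA) ℂ)
      (φ : Fin T → Matrix (Fin dB) (Fin dB) ℂ),
      (∀ s, RankOneProj (ψ s)) ∧ (∀ t, RankOneProj (φ t)) ∧
      χ = ∑ s, ∑ t, (β s t : ℂ) • ((ψ s)ᵀ ⊗ₖ (φ t)ᵀ) := by
  obtain ⟨S, ψ, hψ, hψs⟩ := aux_family dA
  obtain ⟨T, φ, hφ, hφs⟩ := aux_family dB
  have hmem : χ ∈ Submodule.span ℂ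
      (Set.range fun p : Fin S × Fin T => (ψ p.1)ᵀ ⊗ₖ (φ p.2)ᵀ) := by
    rw [matrix_eq_sum_single χ]
    refine Submodule.sum_mem _ fun i _ => Submodule.sum_mem _ fun j _ => ?_
    have h1 : single i j (χ i j)
        = (single i.1 j.1 (χ i j)) ⊗ₖ (single i.2 j.2 (1 : ℂ)) := by
      rw [single_kronecker_single, mul_one]
    rw [h1]
    obtain ⟨a, ha⟩ := hψs (single i.1 j.1 (χ i j))
    obtain ⟨b, hb⟩ := hφs (single i.2 j.2 (1 : ℂ))
    have h2 : (single i.1 j.1 (χ i j)) ⊗ₖ (single i.2 j.2 (1 : ℂ))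
        = ∑ s, ∑ t, (a s * b t) • ((ψ s)ᵀ ⊗ₖ (φ t)ᵀ) := by
      rw [ha, hb]
      ext x y
      simp only [kroneckerMap_apply, Matrix.sum_apply, Matrix.smul_apply, smul_eq_mul, Finset.sum_mul_sum]
      refine Finset.sum_congr rfl fun s _ => Finset.sum_congr rfl fun t _ => ?_
      ring
    rw [h2]
    exact Submodule.sum_mem _ fun s _ => Submodule.sum_mem _ fun t _ =>
      Submodule.smul_mem _ _ (Submodule.subset_span ⟨(s, t), rfl⟩)
  obtain ⟨c, hc⟩ := (Submodule.mem_span_range_iff_exists_fun ℂ).1 hmem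
  refine ⟨S, T, fun s t => (c (s, t)).re, ψ, φ, hψ, hφ, ?_⟩
  have hH : χ = ∑ p : Fin S × Fin T, star (c p) • ((ψ p.1)ᵀ ⊗ₖ (φ p.2)ᵀ) := by
    conv_lhs => rw [← hχ.eq, ← hc]
    rw [conjTranspose_sum]
    refine Finset.sum_congr rfl fun p _ => ?_
    rw [conjTranspose_smul, conjTranspose_kronecker, (hψ p.1).1.transpose.eq,
      (hφ p.2).1.transpose.eq]
  rw [← Fintype.sum_prod_type' (f := fun s t => ((c (s, t)).re : ℂ) • ((ψ s)ᵀ ⊗ₖ (φ t)ᵀ))]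
  have h2 : χ = (1/2 : ℂ) • (χ + χ) := by
    rw [← two_smul ℂ χ, smul_smul]; norm_num
  rw [h2]
  nth_rewrite 1 [← hc]
  nth_rewrite 1 [hH]
  rw [← Finset.sum_add_distrib, Finset.smul_sum]
  refine Finset.sum_congr rfl fun p _ => ?_
  rw [← add_smul, smul_smul]
  congr 1
  rw [Complex.re_eq_add_conj]
  simp only [Complex.star_def]
  ring
end
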